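/- Let p ∈ (−n, 1), ε ∈ (0, 1/3), and let μ be a Borel measure on S^{n-1} with dμ = f dH^{n-1} where τ_1 < f < τ_2 for constants τ_2 > τ_1 > 0. Let {K_m} be a sequence of convex bodies in ℝ^n converging to a convex body K in the Hausdorff metric, and let ξ_m ∈ int K_m with lim_{m→∞} ξ_m = z_0 ∈ ∂K. Then lim_{m→∞} Φ_ε(K_m, ξ_m) = −∞. -/

import Mathlib

open MeasureTheory Metric Set Filter
open scoped ENNReal RealInnerProductSpace NNReal

noncomputable section

abbrev Eu (n : ℕ) : Type := EuclideanSpace ℝ (Fin n)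

def IsConvexBody {n : ℕ} (K : Set (Eu n)) : Prop :=
  Convex ℝ K ∧ IsCompact K ∧ (interior K).Nonempty

def suppFn {n : ℕ} (K : Set (Eu n)) (u : Eu n) : ℝ :=
  sSup ((fun x => ⟪x, u⟫) '' K)

def IsOuterNormal {n : ℕ} (K : Set (Eu n)) (x u : Eu n) : Prop :=
  ‖u‖ = 1 ∧ ∀ y ∈ K, ⟪y, u⟫ ≤ ⟪x, u⟫

def gaussMap {n : ℕ} (K : Set (Eu n)) (x : Eu n) : Eu n :=
  open scoped Classical in
  if h : ∃ u, IsOuterNormal K x u then h.choose else 0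

def lpSurf {n : ℕ} (p : ℝ) (K : Set (Eu n)) (ω : Set (Eu n)) : ℝ≥0∞ :=
  ∫⁻ x in {x ∈ frontier K | gaussMap K x ∈ ω},
    ENNReal.ofReal (⟪x, gaussMap K x⟫ ^ (1 - p)) ∂(μH[(n:ℝ) - 1])


/-- The function `φ` of Section 3: `φ(t) = t^p` for `p ∈ (0,1)`, `log t` for `p = 0`, and
`-t^p` for `p ∈ (-n,0)`. -/
def phiFn (p : ℝ) (t : ℝ) : ℝ :=
  if 0 < p then t ^ p else if p = 0 then Real.log t else -(t ^ p)

/-- The modified energy density `φ_ε`: an increasing, strictly concave function on `(0,∞)`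
with continuous negative second derivative that agrees with `φ` on `[3ε,∞)`, equals
`-t^{-q}` on `(0,ε]`, and satisfies `φ_ε(t) ≥ -t^{-q}` on `(0,1)`. -/
def IsPhiEps (p ε q : ℝ) (φ : ℝ → ℝ) : Prop :=
  StrictMonoOn φ (Set.Ioi 0) ∧
  StrictConcaveOn ℝ (Set.Ioi 0) φ ∧
  (∀ t ∈ Set.Ioi (0:ℝ), DifferentiableAt ℝ φ t ∧ DifferentiableAt ℝ (deriv φ) t ∧
    deriv (deriv φ) t < 0) ∧
  ContinuousOn (deriv (deriv φ)) (Set.Ioi 0) ∧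
  (∀ t : ℝ, 3 * ε ≤ t → φ t = phiFn p t) ∧
  (∀ t : ℝ, 0 < t → t ≤ ε → φ t = -(t ^ (-q))) ∧
  (∀ t ∈ Set.Ioo (0:ℝ) 1, -(t ^ (-q)) ≤ φ t)

/-- The energy `Φ_ε(K, ξ) = ∫_{S^{n-1}} φ_ε (h_K(u) - ⟨u, ξ⟩) dμ(u)`. -/
def PhiE {n : ℕ} (μ : Measure (Eu n)) (φ : ℝ → ℝ) (K : Set (Eu n)) (ξ : Eu n) : ℝ :=
  ∫ u, φ (suppFn K u - ⟪u, ξ⟫) ∂μ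


open Module in
lemma lintegral_ball_ofReal_mul_norm_rpow_neg_eq_top {V : Type*} [NormedAddCommGroup V]
    [NormedSpace ℝ V] [FiniteDimensional ℝ V] [MeasurableSpace V] [BorelSpace V]
    (ν : Measure V) [ν.IsAddHaarMeasure] {q c r : ℝ} (hq : 0 < q) (hdq : (finrank ℝ V : ℝ) ≤ q)
    (hc : 0 < c) (hr : 0 < r) :
    ∫⁻ y in ball (0 : V) r, ENNReal.ofReal (c * ‖y‖) ^ (-q) ∂ν = ⊤ := by
  rcases subsingleton_or_nontrivial V with hV | hV
  · have h : ∀ y : V, ENNReal.ofReal (c * ‖y‖) ^ (-q) = ⊤ := fun y => by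
      simp [Subsingleton.elim y 0, ENNReal.zero_rpow_of_neg (neg_lt_zero.2 hq)]
    simp only [h, lintegral_const, Measure.restrict_apply_univ]
    exact ENNReal.top_mul (measure_ball_pos ν 0 hr).ne'
  · by_contra htop
    have hint : IntegrableOn (fun y : V => (c * ‖y‖) ^ (-q)) (ball 0 r) ν := by
      refine ⟨(by fun_prop : Measurable fun y : V => (c * ‖y‖) ^ (-q)).aestronglyMeasurable, ?_⟩
      rw [hasFiniteIntegral_iff_ofReal (Eventually.of_forall fun y => by positivity)]
      refine lt_of_le_of_lt (lintegral_mono fun y => ?_) (lt_top_iff_ne_top.2 htop)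
      rcases (norm_nonneg y).eq_or_lt with hy | hy
      · simp [← hy, ENNReal.zero_rpow_of_neg (neg_lt_zero.2 hq)]
      · rw [ENNReal.ofReal_rpow_of_pos (mul_pos hc hy)]
    rw [integrableOn_fun_norm_addHaar ν (f := fun t => (c * t) ^ (-q))] at hint
    have hd : 1 ≤ finrank ℝ V := finrank_pos
    have h2 : IntegrableOn (fun t : ℝ => t ^ ((finrank ℝ V : ℝ) - 1 - q)) (Ioo 0 r) := by
      refine IntegrableOn.congr_fun (hint.const_mul (c ^ q)) (fun t ht => ?_) measurableSet_Ioo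
      have h0 : c ^ q * c ^ (-q) = 1 := by rw [← Real.rpow_add hc]; simp
      have h1 : t ^ (finrank ℝ V - 1) * t ^ (-q) = t ^ ((finrank ℝ V : ℝ) - 1 - q) := by
        rw [← Real.rpow_natCast, ← Real.rpow_add ht.1]
        push_cast [hd]
        ring_nf
      simp only [smul_eq_mul, Real.mul_rpow hc.le ht.1.le]
      linear_combination h1 + t ^ (finrank ℝ V - 1) * t ^ (-q) * h0
    rw [intervalIntegral.integrableOn_Ioo_rpow_iff hr] at h2
    linarith

section Sphere

open Module

variable {E : Type*} [NormedAddCommGroup E] [InnerProductSpace ℝ E]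

lemma norm_sq_eq_inner_sq_add_norm_sq_orthogonalProjectionOnto {u₀ : E} (hu₀ : ‖u₀‖ = 1) (x : E) :
    ‖x‖ ^ 2 = ⟪u₀, x⟫ ^ 2 + ‖(ℝ ∙ u₀)ᗮ.orthogonalProjectionOnto x‖ ^ 2 := by
  rw [Submodule.norm_sq_eq_add_norm_sq_projection x (ℝ ∙ u₀)]
  congr 1
  have h := Submodule.starProjection_unit_singleton ℝ hu₀ x
  rw [Submodule.starProjection_apply] at h
  rw [← Submodule.norm_coe, h, norm_smul, hu₀, mul_one, Real.norm_eq_abs, sq_abs]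

lemma norm_sub_le_three_mul_norm_orthogonalProjectionOnto_sub {u₀ u v : E} (hu₀ : ‖u₀‖ = 1)
    (hu : ‖u‖ = 1) (hv : ‖v‖ = 1) (hu' : 1 / 2 ≤ ⟪u₀, u⟫) (hv' : 1 / 2 ≤ ⟪u₀, v⟫) :
    ‖u - v‖ ≤ 3 * ‖(ℝ ∙ u₀)ᗮ.orthogonalProjectionOnto (u - v)‖ := by
  set P := (ℝ ∙ u₀)ᗮ.orthogonalProjectionOnto
  have h1 := norm_sq_eq_inner_sq_add_norm_sq_orthogonalProjectionOnto hu₀ u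
  have h2 := norm_sq_eq_inner_sq_add_norm_sq_orthogonalProjectionOnto hu₀ v
  have h3 := norm_sq_eq_inner_sq_add_norm_sq_orthogonalProjectionOnto hu₀ (u - v)
  have h4 : |‖P v‖ - ‖P u‖| ≤ ‖P (u - v)‖ := by
    rw [map_sub, ← norm_neg (P u - P v), neg_sub]
    exact abs_norm_sub_norm_le _ _
  rw [hu] at h1
  rw [hv] at h2
  rw [inner_sub_right] at h3
  change 1 ^ 2 = _ + ‖P u‖ ^ 2 at h1
  change 1 ^ 2 = _ + ‖P v‖ ^ 2 at h2
  change _ = _ + ‖P (u - v)‖ ^ 2 at h3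
  set a := ⟪u₀, u⟫
  set b := ⟪u₀, v⟫
  have hu1 : ‖P u‖ ≤ 1 := by nlinarith [norm_nonneg (P u)]
  have hv1 : ‖P v‖ ≤ 1 := by nlinarith [norm_nonneg (P v)]
  have key : (a - b) * (a + b) = (‖P v‖ - ‖P u‖) * (‖P v‖ + ‖P u‖) := by nlinarith
  have habs : |a - b| ≤ 2 * ‖P (u - v)‖ := by
    have h5 : |a - b| * (a + b) = |‖P v‖ - ‖P u‖| * (‖P v‖ + ‖P u‖) := by
      rw [← abs_of_nonneg (by linarith : 0 ≤ a + b), ← abs_mul, key, abs_mul,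
        abs_of_nonneg (by positivity : 0 ≤ ‖P v‖ + ‖P u‖)]
    have h6 : |‖P v‖ - ‖P u‖| * (‖P v‖ + ‖P u‖) ≤ ‖P (u - v)‖ * 2 :=
      mul_le_mul h4 (by linarith) (by positivity) (norm_nonneg _)
    nlinarith [abs_nonneg (a - b)]
  refine abs_le_of_sq_le_sq' ?_ (by positivity) |>.2
  have h7 : (a - b) ^ 2 ≤ (2 * ‖P (u - v)‖) ^ 2 := sq_le_sq' (by linarith [neg_abs_le (a - b)])
    ((le_abs_self _).trans habs)
  nlinarith [sq_nonneg ‖P (u - v)‖]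

variable [MeasurableSpace E] [BorelSpace E] {d : ℕ}

lemma hausdorffMeasure_cap_lt_top [Fact (finrank ℝ E = d + 1)] {u₀ : E} (hu₀ : ‖u₀‖ = 1) :
    μH[d] {u : E | ‖u‖ = 1 ∧ 1 / 2 ≤ ⟪u₀, u⟫} < ⊤ := by
  have : FiniteDimensional ℝ E := .of_fact_finrank_eq_succ d
  set C := {u : E | ‖u‖ = 1 ∧ 1 / 2 ≤ ⟪u₀, u⟫}
  let P := (ℝ ∙ u₀)ᗮ.orthogonalProjectionOnto
  have hanti : AntilipschitzWith 3 (fun u : C => P u) := by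
    refine AntilipschitzWith.of_le_mul_dist fun u v => ?_
    rw [Subtype.dist_eq, dist_eq_norm, dist_eq_norm, ← map_sub]
    exact norm_sub_le_three_mul_norm_orthogonalProjectionOnto_sub hu₀ u.2.1 v.2.1 u.2.2 v.2.2
  have hd : (0 : ℝ) ≤ d := by positivity
  have h1 := hanti.hausdorffMeasure_preimage_le hd (closedBall 0 1)
  have h2 : (fun u : C => P u) ⁻¹' closedBall 0 1 = univ := by
    refine eq_univ_of_forall fun u => ?_
    simp only [mem_preimage, mem_closedBall_zero_iff]
    have := norm_sq_eq_inner_sq_add_norm_sq_orthogonalProjectionOnto hu₀ (u : E)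
    rw [u.2.1] at this
    change _ = _ + ‖P u‖ ^ 2 at this
    nlinarith [norm_nonneg (P u), sq_nonneg ⟪u₀, (u : E)⟫]
  rw [h2, ← (isometry_subtype_coe (s := C)).hausdorffMeasure_image (Or.inl hd), image_univ,
    Subtype.range_coe] at h1
  refine h1.trans_lt (ENNReal.mul_lt_top (ENNReal.rpow_lt_top_of_nonneg hd (by simp)) ?_)
  have hfin : finrank ℝ (ℝ ∙ u₀)ᗮ = d :=
    Submodule.finrank_orthogonal_span_singleton (by rintro rfl; simp at hu₀)
  have hH : (μH[d] : Measure (ℝ ∙ u₀)ᗮ).IsAddHaarMeasure := hfin ▸ inferInstance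
  exact (isCompact_closedBall _ _).measure_lt_top

lemma hausdorffMeasure_sphere_lt_top [Fact (finrank ℝ E = d + 1)] :
    μH[d] (sphere (0 : E) 1) < ⊤ := by
  have : FiniteDimensional ℝ E := .of_fact_finrank_eq_succ d
  refine (isCompact_sphere (0 : E) 1).measure_lt_top_of_nhdsWithin fun u₀ hu₀ => ?_
  have hu₀' : ‖u₀‖ = 1 := by simpa using hu₀
  refine ⟨{u : E | ‖u‖ = 1 ∧ 1 / 2 ≤ ⟪u₀, u⟫}, ?_, hausdorffMeasure_cap_lt_top hu₀'⟩
  have hopen : IsOpen {u : E | 1 / 2 < ⟪u₀, u⟫} := isOpen_lt (by fun_prop) (by fun_prop)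
  filter_upwards [self_mem_nhdsWithin, mem_nhdsWithin_of_mem_nhds (hopen.mem_nhds
    (by simp [hu₀']; norm_num))] with u h1 h2
  exact ⟨by simpa using h1, le_of_lt h2⟩

lemma restrict_ball_le_map_orthogonalProjectionOnto {u₀ : E} (hu₀ : ‖u₀‖ = 1) {ρ : ℝ}
    (hρ1 : ρ ≤ 1) :
    (μH[d] : Measure (ℝ ∙ u₀)ᗮ).restrict (ball 0 (ρ / 2)) ≤
      ((μH[d] : Measure E).restrict {u | ‖u‖ = 1 ∧ ‖u - u₀‖ < ρ ∧
        ‖u - u₀‖ ≤ 2 * ‖(ℝ ∙ u₀)ᗮ.orthogonalProjectionOnto u‖}).map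
        (ℝ ∙ u₀)ᗮ.orthogonalProjectionOnto := by
  set P := (ℝ ∙ u₀)ᗮ.orthogonalProjectionOnto
  set A := {u | ‖u‖ = 1 ∧ ‖u - u₀‖ < ρ ∧ ‖u - u₀‖ ≤ 2 * ‖P u‖}
  have hP : Measurable P := P.continuous.measurable
  rw [Measure.le_iff]
  intro B hB
  rw [Measure.map_apply hP hB, Measure.restrict_apply hB, Measure.restrict_apply (hP hB)]
  have hlip : LipschitzWith 1 P := by
    refine (P.lipschitz).weaken ?_
    exact_mod_cast Submodule.orthogonalProjectionOnto_norm_le _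
  have hd : (0 : ℝ) ≤ d := by positivity
  refine le_trans (measure_mono ?_) ((hlip.hausdorffMeasure_image_le hd (P ⁻¹' B ∩ A)).trans ?_)
  · rintro y ⟨hyB, hy⟩
    rw [mem_ball_zero_iff] at hy
    set s := √(1 - ‖y‖ ^ 2)
    have hy0 := norm_nonneg y
    have hs2 : s ^ 2 = 1 - ‖y‖ ^ 2 := Real.sq_sqrt (by nlinarith)
    have hs0 : 0 ≤ s := Real.sqrt_nonneg _
    have hs1 : s ≤ 1 := by nlinarith
    have hyu : ⟪u₀, (y : E)⟫ = 0 := Submodule.mem_orthogonal_singleton_iff_inner_right.1 y.2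
    have hPu : P (y + s • u₀) = y := by
      rw [map_add, map_smul, Submodule.orthogonalProjectionOnto_mem_subspace_eq_self]
      simp [P, Submodule.orthogonalProjectionOnto_orthogonalComplement_singleton_eq_zero]
    have hsq : ∀ c : ℝ, ‖(y : E) + c • u₀‖ ^ 2 = ‖y‖ ^ 2 + c ^ 2 := fun c => by
      rw [norm_add_sq_real, inner_smul_right, real_inner_comm, hyu, norm_smul, hu₀]
      simp
    have hdist : ‖(y : E) + s • u₀ - u₀‖ ≤ 2 * ‖y‖ := by
      refine abs_le_of_sq_le_sq' ?_ (by positivity) |>.2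
      have := hsq (s - 1)
      rw [sub_smul, one_smul, ← add_sub_assoc] at this
      rw [this]
      nlinarith
    refine ⟨y + s • u₀, ⟨by simpa [hPu] using hyB, ?_, by linarith, by rwa [hPu]⟩, hPu⟩
    have := hsq s
    rw [hs2] at this
    nlinarith [norm_nonneg ((y : E) + s • u₀)]
  · simp

lemma setLIntegral_sphere_inter_ball_rpow_neg_eq_top [Fact (finrank ℝ E = d + 1)]
    {q c ρ : ℝ} (hq : 0 < q) (hdq : (d : ℝ) ≤ q) (hc : 0 < c) (hρ : 0 < ρ) {u₀ : E}
    (hu₀ : ‖u₀‖ = 1) :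
    ∫⁻ u in sphere (0 : E) 1 ∩ ball u₀ ρ, ENNReal.ofReal (c * ‖u - u₀‖) ^ (-q) ∂μH[d] = ⊤ := by
  have : FiniteDimensional ℝ E := .of_fact_finrank_eq_succ d
  have hfin : finrank ℝ (ℝ ∙ u₀)ᗮ = d :=
    Submodule.finrank_orthogonal_span_singleton (by rintro rfl; simp at hu₀)
  have hH : (μH[d] : Measure (ℝ ∙ u₀)ᗮ).IsAddHaarMeasure := hfin ▸ inferInstance
  have htop := lintegral_ball_ofReal_mul_norm_rpow_neg_eq_top (μH[d] : Measure (ℝ ∙ u₀)ᗮ) hq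
    (by rwa [hfin]) (by positivity : 0 < 2 * c) (by positivity : 0 < min ρ 1 / 2)
  set P := (ℝ ∙ u₀)ᗮ.orthogonalProjectionOnto
  set A := {u | ‖u‖ = 1 ∧ ‖u - u₀‖ < min ρ 1 ∧ ‖u - u₀‖ ≤ 2 * ‖P u‖}
  rw [← top_le_iff, ← htop]
  have hmeas : ∀ a : ℝ, Measurable fun t : ℝ => ENNReal.ofReal (a * t) ^ (-q) := fun a =>
    by fun_prop
  calc ∫⁻ y in ball (0 : (ℝ ∙ u₀)ᗮ) (min ρ 1 / 2), ENNReal.ofReal (2 * c * ‖y‖) ^ (-q) ∂μH[d]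
      ≤ ∫⁻ y, ENNReal.ofReal (2 * c * ‖y‖) ^ (-q) ∂((μH[d] : Measure E).restrict A).map P :=
        lintegral_mono' (restrict_ball_le_map_orthogonalProjectionOnto hu₀ (min_le_right _ _)) le_rfl
    _ = ∫⁻ u in A, ENNReal.ofReal (2 * c * ‖P u‖) ^ (-q) ∂μH[d] :=
        lintegral_map ((hmeas _).comp measurable_norm) P.continuous.measurable
    _ ≤ ∫⁻ u in A, ENNReal.ofReal (c * ‖u - u₀‖) ^ (-q) ∂μH[d] := by
        refine setLIntegral_mono ((hmeas c).comp (by fun_prop)) fun u hu => ?_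
        rw [ENNReal.rpow_neg, ENNReal.rpow_neg, ENNReal.inv_le_inv]
        refine ENNReal.rpow_le_rpow (ENNReal.ofReal_le_ofReal ?_) hq.le
        nlinarith [hu.2.2]
    _ ≤ _ := lintegral_mono_set fun u (hu : u ∈ A) => show u ∈ sphere (0 : E) 1 ∩ ball u₀ ρ from
        ⟨by simpa using hu.1, by simpa [dist_eq_norm] using hu.2.1.trans_le (min_le_left _ _)⟩

end Sphere

section SuppFn

variable {n : ℕ} {K : Set (Eu n)}

lemma inner_le_suppFn (hK : IsCompact K) {x : Eu n} (hx : x ∈ K) (u : Eu n) :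
    ⟪x, u⟫ ≤ suppFn K u :=
  le_csSup (hK.image (by fun_prop)).bddAbove (mem_image_of_mem _ hx)

lemma suppFn_le (hK : K.Nonempty) {u : Eu n} {a : ℝ} (h : ∀ x ∈ K, ⟪x, u⟫ ≤ a) :
    suppFn K u ≤ a :=
  csSup_le (hK.image _) (forall_mem_image.2 h)

lemma continuous_suppFn (hK : IsCompact K) (hne : K.Nonempty) : Continuous (suppFn K) := by
  obtain ⟨R, hR0, hR⟩ := hK.isBounded.exists_pos_norm_le
  refine (LipschitzWith.of_le_add_mul (Real.toNNReal R) fun u v =>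
    suppFn_le hne fun x hx => ?_).continuous
  have h1 : ⟪x, u⟫ = ⟪x, v⟫ + ⟪x, u - v⟫ := by rw [inner_sub_right]; ring
  have h2 : ⟪x, u - v⟫ ≤ R * ‖u - v‖ := (real_inner_le_norm _ _).trans (by gcongr; exact hR x hx)
  rw [Real.coe_toNNReal _ hR0.le, dist_eq_norm]
  linarith [inner_le_suppFn hK hx v]

lemma inner_lt_suppFn_of_mem_interior (hK : IsCompact K) {x : Eu n} (hx : x ∈ interior K)
    {u : Eu n} (hu : ‖u‖ = 1) : ⟪u, x⟫ < suppFn K u := by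
  obtain ⟨r, hr, hball⟩ := Metric.isOpen_iff.1 isOpen_interior x hx
  have hmem : x + (r / 2) • u ∈ K := interior_subset <| hball <| by
    simp [norm_smul, hu, abs_of_pos hr, hr]
  have h := inner_le_suppFn hK hmem u
  rw [inner_add_left, inner_smul_left, real_inner_self_eq_norm_sq, hu, real_inner_comm] at h
  simp only [conj_trivial] at h
  linarith

lemma IsConvexBody.nonempty (hK : IsConvexBody K) : K.Nonempty := hK.2.2.mono interior_subset

lemma IsConvexBody.exists_isOuterNormal (hK : IsConvexBody K) {z : Eu n} (hz : z ∈ frontier K) :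
    ∃ u, IsOuterNormal K z u := by
  obtain ⟨f, hf⟩ := geometric_hahn_banach_open_point hK.1.interior isOpen_interior hz.2
  obtain ⟨x₀, hx₀⟩ := hK.2.2
  set w := (InnerProductSpace.toDual ℝ (Eu n)).symm f
  have hw : ∀ x, ⟪x, w⟫ = f x := fun x => by
    rw [real_inner_comm]; exact InnerProductSpace.toDual_symm_apply
  have hw0 : w ≠ 0 := fun h => by
    have h1 := hf x₀ hx₀
    simp [← hw, h] at h1
  have hle : ∀ y ∈ K, f y ≤ f z := fun y hy => by
    have hmem : y ∈ closure (interior K) := by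
      rw [hK.1.closure_interior_eq_closure_of_nonempty_interior hK.2.2]
      exact subset_closure hy
    exact closure_minimal (fun a ha => (hf a ha).le)
      (isClosed_le f.continuous continuous_const) hmem
  refine ⟨(‖w‖)⁻¹ • w, by simp [norm_smul, hw0], fun y hy => ?_⟩
  rw [inner_smul_right, inner_smul_right, hw, hw]
  exact mul_le_mul_of_nonneg_left (hle y hy) (by positivity)

lemma suppFn_sub_inner_le {L : Set (Eu n)} (hK : IsConvexBody K) (hL : IsConvexBody L)
    {R η : ℝ} {z ξ u₀ u : Eu n} (hu₀ : IsOuterNormal K z u₀) (hu : ‖u‖ = 1)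
    (hR : ∀ y ∈ K, ‖y - z‖ ≤ R) (hη : hausdorffDist L K < η) :
    suppFn L u - ⟪u, ξ⟫ ≤ R * ‖u - u₀‖ + (η + ‖ξ - z‖) := by
  rw [sub_le_iff_le_add]
  refine suppFn_le hL.nonempty fun x hx => ?_
  obtain ⟨y, hy, hxy⟩ := exists_dist_lt_of_hausdorffDist_lt hx hη
    (hausdorffEDist_ne_top_of_nonempty_of_bounded hL.nonempty hK.nonempty
      hL.2.1.isBounded hK.2.1.isBounded)
  rw [dist_eq_norm] at hxy
  have h1 : ⟪x, u⟫ = ⟪y - z, u - u₀⟫ + (⟪y, u₀⟫ - ⟪z, u₀⟫) + ⟪x - y, u⟫ - ⟪ξ - z, u⟫ + ⟪u, ξ⟫ := by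
    rw [real_inner_comm ξ u]
    simp only [inner_sub_left, inner_sub_right]
    ring
  have h2 : ⟪y - z, u - u₀⟫ ≤ R * ‖u - u₀‖ :=
    (real_inner_le_norm _ _).trans (by gcongr; exact hR y hy)
  have h3 : ⟪x - y, u⟫ ≤ ‖x - y‖ := by simpa [hu] using real_inner_le_norm (x - y) u
  have h4 : -⟪ξ - z, u⟫ ≤ ‖ξ - z‖ := by
    simpa [hu] using (neg_le_abs _).trans (abs_real_inner_le_norm (ξ - z) u)
  linarith [hu₀.2 y hy]

end SuppFn

section WithDensity

variable {α : Type*} [MeasurableSpace α] {ν : Measure α} {s : Set α} {f : α → ℝ} {c : ℝ}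

lemma ofReal_smul_restrict_le_withDensity (hs : MeasurableSet s) (h : ∀ x ∈ s, c ≤ f x) :
    ENNReal.ofReal c • ν.restrict s ≤ (ν.restrict s).withDensity fun x => ENNReal.ofReal (f x) := by
  rw [← withDensity_const]
  refine withDensity_mono ?_
  filter_upwards [ae_restrict_mem hs] with x hx using ENNReal.ofReal_le_ofReal (h x hx)

lemma withDensity_le_ofReal_smul_restrict (hs : MeasurableSet s) (h : ∀ x ∈ s, f x ≤ c) :
    (ν.restrict s).withDensity (fun x => ENNReal.ofReal (f x)) ≤
      ENNReal.ofReal c • ν.restrict s := by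
  rw [← withDensity_const]
  refine withDensity_mono ?_
  filter_upwards [ae_restrict_mem hs] with x hx using ENNReal.ofReal_le_ofReal (h x hx)

end WithDensity

lemma tendsto_integral_atBot_of_lintegral_liminf_eq_top {α : Type*} [MeasurableSpace α]
    {μ : Measure α} [IsFiniteMeasure μ] {F : ℕ → α → ℝ} {g : ℕ → α → ℝ≥0∞} {C : ℝ}
    (hF : ∀ m, Integrable (F m) μ) (hC : ∀ᶠ m in atTop, ∀ᵐ x ∂μ, F m x ≤ C)
    (hgm : ∀ m, Measurable (g m))
    (hg : ∀ᶠ m in atTop, ∀ᵐ x ∂μ, g m x ≤ ENNReal.ofReal (C - F m x))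
    (htop : ∫⁻ x, liminf (fun m => g m x) atTop ∂μ = ⊤) :
    Tendsto (fun m => ∫ x, F m x ∂μ) atTop atBot := by
  have hlim : Tendsto (fun m => ∫⁻ x, g m x ∂μ) atTop (nhds ⊤) :=
    tendsto_of_le_liminf_of_limsup_le (htop.ge.trans (lintegral_liminf_le hgm)) le_top
  have h1 : Tendsto (fun m => ∫ x, (C - F m x) ∂μ) atTop atTop := by
    rw [← ENNReal.tendsto_ofReal_nhds_top]
    refine tendsto_nhds_top_mono hlim ?_
    filter_upwards [hC, hg] with m hCm hgm
    rw [ofReal_integral_eq_lintegral_ofReal (f := fun x => C - F m x)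
      ((integrable_const C).sub (hF m))
      (by filter_upwards [hCm] with x hx using sub_nonneg.2 hx)]
    exact lintegral_mono_ae hgm
  have h2 : ∀ m, ∫ x, F m x ∂μ = ∫ _, C ∂μ + -∫ x, (C - F m x) ∂μ := fun m => by
    rw [integral_sub (integrable_const C) (hF m)]
    ring
  simp only [h2]
  exact tendsto_atBot_add_const_left _ _ (tendsto_neg_atTop_atBot.comp h1)

lemma IsPhiEps.exponent_pos {p ε q : ℝ} {φ : ℝ → ℝ} (hφ : IsPhiEps p ε q φ) (hε : 0 < ε)
    (hq : 0 ≤ q) : 0 < q := by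
  refine hq.lt_of_ne fun h => ?_
  have h1 := hφ.1 (show ε / 2 ∈ Ioi 0 from half_pos hε) (show ε ∈ Ioi 0 from hε) (half_lt_self hε)
  rw [hφ.2.2.2.2.2.1 _ (half_pos hε) (half_le_self hε.le), hφ.2.2.2.2.2.1 _ hε le_rfl, ← h] at h1
  simp at h1

lemma IsPhiEps.continuousOn {p ε q : ℝ} {φ : ℝ → ℝ} (hφ : IsPhiEps p ε q φ) :
    ContinuousOn φ (Ioi 0) :=
  fun t ht => (hφ.2.2.1 t ht).1.continuousAt.continuousWithinAt

/-- Lemma 3.1: if convex bodies `K_m → K` in the Hausdorff metric and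
`ξ_m ∈ int K_m` converge to a boundary point `z₀ ∈ ∂K`, then `Φ_ε(K_m, ξ_m) → -∞`. -/
theorem energy_tendsto_atBot_of_center_to_boundary
    (n : ℕ) (p ε q τ₁ τ₂ : ℝ)
    (hp : -(n : ℝ) < p ∧ p < 1) (hε : ε ∈ Set.Ioo (0:ℝ) (1/3))
    (hq : q = max |p| ((n : ℝ) - 1))
    (φ : ℝ → ℝ) (hφ : IsPhiEps p ε q φ)
    (hτ : 0 < τ₁ ∧ τ₁ < τ₂)
    (f : Eu n → ℝ) (hf : ∀ u ∈ sphere (0 : Eu n) 1, τ₁ < f u ∧ f u < τ₂)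
    (μ : Measure (Eu n))
    (hμ : μ = ((μH[(n:ℝ) - 1]).restrict (sphere (0 : Eu n) 1)).withDensity
      (fun u => ENNReal.ofReal (f u)))
    (Km : ℕ → Set (Eu n)) (hKm : ∀ m, IsConvexBody (Km m))
    (K : Set (Eu n)) (hK : IsConvexBody K)
    (hconv : Filter.Tendsto (fun m => Metric.hausdorffDist (Km m) K)
      Filter.atTop (nhds 0))
    (ξm : ℕ → Eu n) (hξm : ∀ m, ξm m ∈ interior (Km m))
    (z₀ : Eu n) (hz₀ : z₀ ∈ frontier K)
    (hξconv : Filter.Tendsto ξm Filter.atTop (nhds z₀)) :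
    Filter.Tendsto (fun m => PhiE μ φ (Km m) (ξm m)) Filter.atTop Filter.atBot := by
  obtain ⟨u₀, hu₀⟩ := hK.exists_isOuterNormal hz₀
  obtain ⟨d, rfl⟩ : ∃ d, n = d + 1 := Nat.exists_eq_succ_of_ne_zero <| by
    rintro rfl
    simpa [Subsingleton.elim u₀ 0] using hu₀.1
  have hfact : Fact (Module.finrank ℝ (Eu (d + 1)) = d + 1) := ⟨by simp⟩
  have hdim : ((d + 1 : ℕ) : ℝ) - 1 = d := by simp
  rw [hdim] at hq hμ
  have hq0 : 0 < q := hφ.exponent_pos hε.1 (hq ▸ le_max_of_le_left (abs_nonneg p))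
  have hdq : (d : ℝ) ≤ q := hq ▸ le_max_right _ _
  set S := sphere (0 : Eu (d + 1)) 1 with hS
  have hSm : MeasurableSet S := isClosed_sphere.measurableSet
  have hμ_lower : ENNReal.ofReal τ₁ • (μH[(d : ℝ)]).restrict S ≤ μ :=
    hμ ▸ ofReal_smul_restrict_le_withDensity hSm fun u hu => (hf u hu).1.le
  have hμ_upper : μ ≤ ENNReal.ofReal τ₂ • (μH[(d : ℝ)]).restrict S :=
    hμ ▸ withDensity_le_ofReal_smul_restrict hSm fun u hu => (hf u hu).2.le
  have hfin : IsFiniteMeasure μ := by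
    refine ⟨(hμ_upper univ).trans_lt ?_⟩
    simpa using ENNReal.mul_lt_top ENNReal.ofReal_lt_top hausdorffMeasure_sphere_lt_top
  have hae : ∀ᵐ u ∂μ, ‖u‖ = 1 := by
    rw [hμ]
    filter_upwards [withDensity_absolutelyContinuous _ _ (ae_restrict_mem hSm)] with u hu
    simpa [hS] using hu
  have hpos : ∀ m u, ‖u‖ = 1 → 0 < suppFn (Km m) u - ⟪u, ξm m⟫ := fun m u hu =>
    sub_pos.2 (inner_lt_suppFn_of_mem_interior (hKm m).2.1 (hξm m) hu)
  obtain ⟨R, hR0, hR⟩ : ∃ R > 0, ∀ y ∈ K, ‖y - z₀‖ ≤ R := by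
    obtain ⟨R, hR0, hR⟩ := hK.2.1.isBounded.exists_pos_norm_le
    refine ⟨R + ‖z₀‖, by positivity, fun y hy => ?_⟩
    linarith [norm_sub_le y z₀, hR y hy]
  let δ : ℕ → ℝ := fun m => hausdorffDist (Km m) K + 1 / ((m : ℝ) + 1) + ‖ξm m - z₀‖
  have hδ0 : ∀ m, 0 < δ m := fun m => by
    have := hausdorffDist_nonneg (s := Km m) (t := K)
    positivity
  have hδ : Tendsto δ atTop (nhds 0) := by
    simpa [δ] using (hconv.add tendsto_one_div_add_atTop_nhds_zero_nat).add
      (tendsto_iff_norm_sub_tendsto_zero.1 hξconv)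
  have hupper : ∀ m u, ‖u‖ = 1 → suppFn (Km m) u - ⟪u, ξm m⟫ ≤ R * ‖u - u₀‖ + δ m :=
    fun m u hu => suppFn_sub_inner_le hK (hKm m) hu₀ hu hR (lt_add_of_pos_right _ (by positivity))
  obtain ⟨ρ, hρ0, hρ⟩ : ∃ ρ > 0, R * ρ ≤ ε / 2 :=
    ⟨ε / 2 / R, div_pos (half_pos hε.1) hR0, (mul_div_cancel₀ _ hR0.ne').le⟩
  let A := S ∩ ball u₀ ρ
  have hA : MeasurableSet A := hSm.inter measurableSet_ball
  refine tendsto_integral_atBot_of_lintegral_liminf_eq_top (C := max 0 (φ (R * 2 + 1)))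
    (g := fun m => A.indicator fun u => ENNReal.ofReal (R * ‖u - u₀‖ + δ m) ^ (-q))
    (fun m => ?_) ?_ (fun m => Measurable.indicator (by fun_prop) hA) ?_ ?_
  · rw [← Measure.restrict_eq_self_of_ae_mem (s := S) (hae.mono fun u hu => by simpa [hS] using hu)]
    refine ContinuousOn.integrableOn_compact (isCompact_sphere _ _)
      (hφ.continuousOn.comp (Continuous.continuousOn ?_) fun u hu =>
        hpos m u (by simpa [hS] using hu))
    exact (continuous_suppFn (hKm m).2.1 (hKm m).nonempty).sub (by fun_prop)
  · filter_upwards [hδ.eventually_lt_const one_pos] with m hm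
    filter_upwards [hae] with u hu
    refine le_max_of_le_right (hφ.1.monotoneOn (hpos m u hu) (by simp; positivity)
      ((hupper m u hu).trans ?_))
    have : ‖u - u₀‖ ≤ 2 := (norm_sub_le _ _).trans (by rw [hu, hu₀.1]; norm_num)
    gcongr
  · filter_upwards [hδ.eventually_lt_const (half_pos hε.1)] with m hm
    filter_upwards [hae] with u hu
    by_cases hA' : u ∈ A
    · have hrad : ‖u - u₀‖ < ρ := by simpa [dist_eq_norm] using hA'.2
      have ht0 : 0 < R * ‖u - u₀‖ + δ m := add_pos_of_nonneg_of_pos (by positivity) (hδ0 m)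
      have htε : R * ‖u - u₀‖ + δ m ≤ ε := by nlinarith
      have hle := hφ.1.monotoneOn (hpos m u hu) ht0 (hupper m u hu)
      rw [hφ.2.2.2.2.2.1 _ ht0 htε] at hle
      rw [indicator_of_mem hA', ENNReal.ofReal_rpow_of_pos ht0]
      exact ENNReal.ofReal_le_ofReal (by linarith [le_max_left 0 (φ (R * 2 + 1))])
    · simp [indicator_of_notMem hA']
  · have hind : ∀ u, liminf (fun m => A.indicator
        (fun u => ENNReal.ofReal (R * ‖u - u₀‖ + δ m) ^ (-q)) u) atTop =
        A.indicator (fun u => ENNReal.ofReal (R * ‖u - u₀‖) ^ (-q)) u := fun u => by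
      refine Tendsto.liminf_eq ?_
      by_cases hu : u ∈ A
      · simp only [indicator_of_mem hu]
        refine (ENNReal.continuous_rpow_const.tendsto _).comp (ENNReal.tendsto_ofReal ?_)
        simpa using hδ.const_add (R * ‖u - u₀‖)
      · simp [indicator_of_notMem hu]
    simp only [hind]
    rw [← top_le_iff]
    refine le_trans ?_ (lintegral_mono' hμ_lower le_rfl)
    rw [lintegral_smul_measure, lintegral_indicator hA, Measure.restrict_restrict hA,
      inter_eq_self_of_subset_left inter_subset_left,
      setLIntegral_sphere_inter_ball_rpow_neg_eq_top hq0 hdq hR0 hρ0 hu₀.1, smul_eq_mul,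
      ENNReal.mul_top (by simpa using hτ.1)]

end
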